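/- Fix z_R > 0, λ_a > 0 and a nonzero mode l_m ∈ ℤ. For a wavelength λ_i > 0, modes l₁, l₂ ∈ ℤ with l₁ ≠ 0, a fixed z > 0 and β₁, β₂ > 0, write a_i^{l₁,l₂}(β, z) = g(λ_i, l₁, β·r_max(λ_a, l_m, z), z) / g(λ_i, l₂, β·r_max(λ_a, l_m, z), z). Then a_i^{l₁,l₂}(β₁, z) / a_i^{l₁,l₂}(β₂, z) = (β₁/β₂)^{2(|l₁|−|l₂|)}. In particular, the ratio equals 1 whenever β₁ = β₂. -/

import Mathlib

open scoped BigOperators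

/-- Squared beam waist: `ω(λ)² = λ·z_R/π`. -/
noncomputable def waistSq (zR lam : ℝ) : ℝ := lam * zR / Real.pi

/-- Squared beam spot at axial distance `z`: `ω(λ,z)² = ω(λ)²·(1 + z²/z_R²)`. -/
noncomputable def spotSq (zR lam z : ℝ) : ℝ := waistSq zR lam * (1 + z ^ 2 / zR ^ 2)

/-- Maximum-strength radius `r_max(λ,l,z) = √(|l|/2)·ω(λ,z)`. -/
noncomputable def rmax (zR lam : ℝ) (l : ℤ) (z : ℝ) : ℝ :=
  Real.sqrt ((l.natAbs : ℝ) / 2 * spotSq zR lam z)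

/-- `d_m(λ,l,z) = √(r_max(λ,l,z)² + z²)`; in particular `d_m(λ,0,z) = z` for `z > 0`. -/
noncomputable def dm (zR lam : ℝ) (l : ℤ) (z : ℝ) : ℝ :=
  Real.sqrt (rmax zR lam l z ^ 2 + z ^ 2)

/-- OAM link gain at radius `r` and axial distance `z` (Equation (2) of the paper). -/
noncomputable def gain (zR lam : ℝ) (l : ℤ) (r z : ℝ) : ℝ :=
  if l = 0 then
    lam ^ 2 / ((4 * Real.pi) ^ 2 * z ^ 2) * Real.exp (-2 * r ^ 2 / spotSq zR lam z)
  else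
    lam ^ 2 / ((4 * Real.pi) ^ 2 * dm zR lam l z ^ 2) *
      (r / rmax zR lam l z) ^ (2 * l.natAbs) *
      Real.exp (2 * (rmax zR lam l z ^ 2 - r ^ 2) / spotSq zR lam z)

lemma spotSq_pos' (zR lam z : ℝ) (hzR : 0 < zR) (hlam : 0 < lam) : 0 < spotSq zR lam z := by
  unfold spotSq waistSq
  have := Real.pi_pos
  positivity

lemma rmax_pos' (zR lam z : ℝ) (l : ℤ) (hzR : 0 < zR) (hlam : 0 < lam) (hl : l ≠ 0) :
    0 < rmax zR lam l z := by
  unfold rmax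
  have := spotSq_pos' zR lam z hzR hlam
  have h2 : 0 < (l.natAbs : ℝ) := by exact_mod_cast Int.natAbs_pos.mpr hl
  positivity

lemma gain_form (zR lam R z : ℝ) (l : ℤ) (hzR : 0 < zR) (hlam : 0 < lam) (hz : 0 < z)
    (hR : 0 < R) :
    ∃ C : ℝ, 0 < C ∧ ∀ β : ℝ, gain zR lam l (β * R) z =
      C * β ^ (2 * l.natAbs) * Real.exp (-2 * (β * R) ^ 2 / spotSq zR lam z) := by
  have hpi := Real.pi_pos
  by_cases hl : l = 0
  · refine ⟨lam ^ 2 / ((4 * Real.pi) ^ 2 * z ^ 2), by positivity, fun β => ?_⟩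
    simp [gain, hl]
  · have hr := rmax_pos' zR lam z l hzR hlam hl
    have hd : 0 < dm zR lam l z := by
      unfold dm
      positivity
    refine ⟨lam ^ 2 / ((4 * Real.pi) ^ 2 * dm zR lam l z ^ 2) *
      (R / rmax zR lam l z) ^ (2 * l.natAbs) *
      Real.exp (2 * rmax zR lam l z ^ 2 / spotSq zR lam z), by positivity, fun β => ?_⟩
    have e : 2 * (rmax zR lam l z ^ 2 - (β * R) ^ 2) / spotSq zR lam z =
        2 * rmax zR lam l z ^ 2 / spotSq zR lam z + -2 * (β * R) ^ 2 / spotSq zR lam z := by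
      ring
    rw [gain, if_neg hl, e, Real.exp_add, mul_div_assoc, mul_pow]
    ring

/-- Equation (11), second identity: the same-wavelength cross-mode gain ratio
`a_i^{l₁,l₂}(β, z)` at two lateral positions `β₁, β₂` satisfies
`a(β₁)/a(β₂) = (β₁/β₂)^{2(|l₁|−|l₂|)}`; in particular it equals `1` whenever `β₁ = β₂`. -/
theorem gain_ratio_cross_mode_depends_only_on_beta
    (zR lamA : ℝ) (lm : ℤ) (hzR : 0 < zR) (hlamA : 0 < lamA) (hlm : lm ≠ 0)
    (lamI : ℝ) (hlamI : 0 < lamI) (l₁ l₂ : ℤ) (hl₁ : l₁ ≠ 0)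
    (z β₁ β₂ : ℝ) (hz : 0 < z) (hβ₁ : 0 < β₁) (hβ₂ : 0 < β₂) :
    (gain zR lamI l₁ (β₁ * rmax zR lamA lm z) z / gain zR lamI l₂ (β₁ * rmax zR lamA lm z) z) /
      (gain zR lamI l₁ (β₂ * rmax zR lamA lm z) z / gain zR lamI l₂ (β₂ * rmax zR lamA lm z) z) =
      (β₁ / β₂) ^ (2 * ((l₁.natAbs : ℤ) - (l₂.natAbs : ℤ))) ∧
    (β₁ = β₂ →
      (gain zR lamI l₁ (β₁ * rmax zR lamA lm z) z / gain zR lamI l₂ (β₁ * rmax zR lamA lm z) z) /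
        (gain zR lamI l₁ (β₂ * rmax zR lamA lm z) z / gain zR lamI l₂ (β₂ * rmax zR lamA lm z) z)
        = 1) := by
  have key : (gain zR lamI l₁ (β₁ * rmax zR lamA lm z) z /
        gain zR lamI l₂ (β₁ * rmax zR lamA lm z) z) /
      (gain zR lamI l₁ (β₂ * rmax zR lamA lm z) z / gain zR lamI l₂ (β₂ * rmax zR lamA lm z) z) =
      (β₁ / β₂) ^ (2 * ((l₁.natAbs : ℤ) - (l₂.natAbs : ℤ))) := by
    have hR := rmax_pos' zR lamA z lm hzR hlamA hlm
    obtain ⟨C₁, hC₁, h₁⟩ := gain_form zR lamI _ z l₁ hzR hlamI hz hR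
    obtain ⟨C₂, hC₂, h₂⟩ := gain_form zR lamI _ z l₂ hzR hlamI hz hR
    rw [h₁, h₁, h₂, h₂]
    have hb : β₁ / β₂ ≠ 0 := by positivity
    have e : (β₁ / β₂) ^ (2 * ((l₁.natAbs : ℤ) - (l₂.natAbs : ℤ))) =
        (β₁ / β₂) ^ (2 * l₁.natAbs) / (β₁ / β₂) ^ (2 * l₂.natAbs) := by
      rw [mul_sub, zpow_sub₀ hb]
      norm_cast
    rw [e, div_pow, div_pow]
    have hE₁ := Real.exp_pos (-2 * (β₁ * rmax zR lamA lm z) ^ 2 / spotSq zR lamI z)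
    have hE₂ := Real.exp_pos (-2 * (β₂ * rmax zR lamA lm z) ^ 2 / spotSq zR lamI z)
    generalize Real.exp (-2 * (β₁ * rmax zR lamA lm z) ^ 2 / spotSq zR lamI z) = E₁ at *
    generalize Real.exp (-2 * (β₂ * rmax zR lamA lm z) ^ 2 / spotSq zR lamI z) = E₂ at *
    have p1 := pow_pos hβ₁ (2 * l₁.natAbs)
    have p2 := pow_pos hβ₁ (2 * l₂.natAbs)
    have p3 := pow_pos hβ₂ (2 * l₁.natAbs)
    have p4 := pow_pos hβ₂ (2 * l₂.natAbs)
    generalize β₁ ^ (2 * l₁.natAbs) = a at *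
    generalize β₁ ^ (2 * l₂.natAbs) = b at *
    generalize β₂ ^ (2 * l₁.natAbs) = c at *
    generalize β₂ ^ (2 * l₂.natAbs) = d at *
    field_simp
  refine ⟨key, fun h => ?_⟩
  rw [key, h, div_self hβ₂.ne', one_zpow]
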